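/- Let τ be a conformal transformation of 𝕊² with center of mass a = a_τ, and let u: 𝕊² → ℝ be measurable with ∫_{𝕊²} e^{2u} dω < ∞. Then (∫_{𝕊²} e^{2u} dω)² − |∫_{𝕊²} ω e^{2u} dω|² = (1 − |a|²)·[(∫_{𝕊²} (1 − a·τ^{−1}(ω))^{−1} e^{2u} dω)² − |∫_{𝕊²} τ^{−1}(ω)·(1 − a·τ^{−1}(ω))^{−1} e^{2u} dω|²], where a·ω denotes the Euclidean inner product in ℝ³ and |·| the Euclidean norm. -/

import Mathlib

open MeasureTheory
open scoped Classical

noncomputable section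

/-- Squared Euclidean norm on `ℝ²`. -/
def sq2 (x : ℝ × ℝ) : ℝ := x.1 ^ 2 + x.2 ^ 2

/-- Euclidean dot product on `ℝ³`. -/
def dot3 (a b : Fin 3 → ℝ) : ℝ := a 0 * b 0 + a 1 * b 1 + a 2 * b 2

/-- Squared Euclidean norm on `ℝ³`. -/
def norm3sq (a : Fin 3 → ℝ) : ℝ := dot3 a a

/-- Stereographic projection from the north pole. -/
def SP (ω : Fin 3 → ℝ) : ℝ × ℝ := (ω 0 / (1 - ω 2), ω 1 / (1 - ω 2))

/-- Inverse stereographic projection. -/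
def SPinv (x : ℝ × ℝ) : Fin 3 → ℝ :=
  ![2 * x.1 / (1 + sq2 x), 2 * x.2 / (1 + sq2 x), (sq2 x - 1) / (1 + sq2 x)]

/-- Identification `ℝ² ≅ ℂ`. -/
def cx (x : ℝ × ℝ) : ℂ := ⟨x.1, x.2⟩

/-- Identification `ℂ ≅ ℝ²`. -/
def uncx (z : ℂ) : ℝ × ℝ := (z.re, z.im)

/-- The group `SL(2,ℂ)`. -/
abbrev SL2C := Matrix.SpecialLinearGroup (Fin 2) ℂ

/-- The Möbius transformation associated to `A ∈ SL(2,ℂ)`. -/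
def TA (A : SL2C) (z : ℂ) : ℂ := (A.1 0 0 * z + A.1 0 1) / (A.1 1 0 * z + A.1 1 1)

/-- The north pole of `𝕊²`. -/
def northPole : Fin 3 → ℝ := ![0, 0, 1]

/-- The conformal transformation of `𝕊²` induced by `A ∈ SL(2,ℂ)` via stereographic
projection, extended continuously over the poles. -/
def tauA (A : SL2C) (ω : Fin 3 → ℝ) : Fin 3 → ℝ :=
  if ω 2 = 1 then
    if A.1 1 0 = 0 then northPole else SPinv (uncx (A.1 0 0 / A.1 1 0))
  else if A.1 1 0 * cx (SP ω) + A.1 1 1 = 0 then northPole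
  else SPinv (uncx (TA A (cx (SP ω))))

/-- The Jacobian `𝒥_{τ_A}(ω) = ((1+|z|²)/(|az+b|²+|cz+d|²))²`, `z = 𝒮(ω)`,
extended continuously over the north pole. -/
def jacA (A : SL2C) (ω : Fin 3 → ℝ) : ℝ :=
  if ω 2 = 1 then (1 / (Complex.normSq (A.1 0 0) + Complex.normSq (A.1 1 0))) ^ 2
  else
    ((1 + Complex.normSq (cx (SP ω))) /
        (Complex.normSq (A.1 0 0 * cx (SP ω) + A.1 0 1) +
          Complex.normSq (A.1 1 0 * cx (SP ω) + A.1 1 1))) ^ 2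

/-- `∫_{𝕊²} f dω = (1/π) ∫_{ℝ²} f(𝒮⁻¹(x)) (1+|x|²)⁻² dx`, the integral against the
normalized surface measure of `𝕊²`, written in stereographic coordinates. -/
def sphInt {E : Type*} [NormedAddCommGroup E] [NormedSpace ℝ E]
    (f : (Fin 3 → ℝ) → E) : E :=
  (1 / Real.pi) • ∫ x : ℝ × ℝ, ((1 + sq2 x)⁻¹) ^ 2 • f (SPinv x)

/-- Integrability of `f : 𝕊² → ℝ` with respect to the normalized surface measure,
expressed in stereographic coordinates. -/
def SphIntegrable (f : (Fin 3 → ℝ) → ℝ) : Prop :=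
  Integrable fun x : ℝ × ℝ => ((1 + sq2 x)⁻¹) ^ 2 * f (SPinv x)

/-- The mass `M_τ = ∫_{𝕊²} 𝒥_τ^{3/2} dω`. -/
def massA (A : SL2C) : ℝ := sphInt fun ω => jacA A ω ^ (3 / 2 : ℝ)

/-- The center of mass `a_τ = M_τ⁻¹ ∫_{𝕊²} ω 𝒥_τ^{3/2}(ω) dω`. -/
def comA (A : SL2C) : Fin 3 → ℝ :=
  (massA A)⁻¹ • sphInt fun ω => jacA A ω ^ (3 / 2 : ℝ) • ω

/-- The normalizing constant `c_τ = -(1/2) ln M_τ`. -/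
def cA (A : SL2C) : ℝ := -(1 / 2) * Real.log (massA A)

/-- `ψ_τ = (3/4) ln 𝒥_τ + c_τ`. -/
def psiA (A : SL2C) (ω : Fin 3 → ℝ) : ℝ := (3 / 4) * Real.log (jacA A ω) + cA A

/-- `|∇v(x)|²` for `v : ℝ² → ℝ`. -/
def gradSq (v : ℝ × ℝ → ℝ) (x : ℝ × ℝ) : ℝ :=
  fderiv ℝ v x (1, 0) ^ 2 + fderiv ℝ v x (0, 1) ^ 2

/-- The Dirichlet energy `∫_{𝕊²} |∇_{𝕊²} u|² dω = (1/(4π)) ∫_{ℝ²} |∇(u∘𝒮⁻¹)(x)|² dx`. -/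
def gradTerm (u : (Fin 3 → ℝ) → ℝ) : ℝ :=
  (1 / (4 * Real.pi)) * ∫ x : ℝ × ℝ, gradSq (fun y => u (SPinv y)) x

/-- Membership in the Sobolev space `H¹(𝕊²)`. -/
def MemH1 (u : (Fin 3 → ℝ) → ℝ) : Prop :=
  SphIntegrable u ∧ SphIntegrable (fun ω => u ω ^ 2) ∧
    Integrable fun x : ℝ × ℝ => gradSq (fun y => u (SPinv y)) x

/-- The Chang–Gui functional `I_α`. -/
def CG (α : ℝ) (u : (Fin 3 → ℝ) → ℝ) : ℝ :=
  α * gradTerm u + 2 * sphInt u -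
    (1 / 2) * Real.log
      ((sphInt fun ω => Real.exp (2 * u ω)) ^ 2 -
        norm3sq (sphInt fun ω => Real.exp (2 * u ω) • ω))

end

lemma aux_sq2_nonneg (x : ℝ × ℝ) : 0 ≤ sq2 x := by unfold sq2; positivity

lemma aux_pos (x : ℝ × ℝ) : 0 < 1 + sq2 x := by linarith [aux_sq2_nonneg x]

lemma aux_SPinv0 (x : ℝ × ℝ) : SPinv x 0 = 2 * x.1 / (1 + sq2 x) := rfl

lemma aux_SPinv1 (x : ℝ × ℝ) : SPinv x 1 = 2 * x.2 / (1 + sq2 x) := rfl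

lemma aux_SPinv2 (x : ℝ × ℝ) : SPinv x 2 = (sq2 x - 1) / (1 + sq2 x) := rfl

lemma aux_SPinv_ne (x : ℝ × ℝ) : SPinv x 2 ≠ 1 := by
  rw [aux_SPinv2]
  have := aux_pos x
  intro h
  rw [div_eq_one_iff_eq this.ne'] at h
  linarith

lemma aux_SP_SPinv (x : ℝ × ℝ) : SP (SPinv x) = x := by
  have h := (aux_pos x).ne'
  have h2 : 1 - (sq2 x - 1) / (1 + sq2 x) = 2 / (1 + sq2 x) := by field_simp; ring
  unfold SP
  rw [aux_SPinv0, aux_SPinv1, aux_SPinv2, h2]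
  ext <;> simp only [] <;> field_simp

lemma aux_radial1 {P e : ℝ} (hP : 0 < P) (he : 0 < e) :
    ∫ r in Set.Ioi (0 : ℝ), r * ((P * r ^ 2 + e)⁻¹) ^ 3 = 1 / (4 * P * e ^ 2) := by
  have hpos : ∀ r : ℝ, 0 < P * r ^ 2 + e := fun r => by positivity
  have hd : ∀ r ∈ Set.Ici (0 : ℝ), HasDerivAt
      (fun r : ℝ => - (1 / (4 * P)) * ((P * r ^ 2 + e)⁻¹) ^ 2)
      (r * ((P * r ^ 2 + e)⁻¹) ^ 3) r := by
    intro r _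
    have h1 : HasDerivAt (fun r : ℝ => P * r ^ 2 + e) (P * (2 * r)) r := by
      simpa using ((hasDerivAt_pow 2 r).const_mul P).add_const e
    have h2 := ((h1.inv (hpos r).ne').pow 2).const_mul (- (1 / (4 * P)))
    refine h2.congr_deriv ?_
    have := (hpos r).ne'
    simp only [Pi.inv_apply, Nat.cast_ofNat, Nat.add_one_sub_one, pow_one]
    field_simp
    norm_num
  have ht : Filter.Tendsto (fun r : ℝ => - (1 / (4 * P)) * ((P * r ^ 2 + e)⁻¹) ^ 2)
      Filter.atTop (nhds (- (1 / (4 * P)) * 0 ^ 2)) := by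
    refine Filter.Tendsto.const_mul _ (Filter.Tendsto.pow ?_ 2)
    refine Filter.Tendsto.comp tendsto_inv_atTop_zero ?_
    refine Filter.tendsto_atTop_add_const_right _ _ ?_
    exact (Filter.tendsto_pow_atTop (by norm_num)).const_mul_atTop hP
  rw [integral_Ioi_of_hasDerivAt_of_nonneg' hd
    (fun r hr => by have := hpos r; have hr : 0 < r := hr; positivity) ht]
  field_simp
  simp

lemma aux_radial3 {P e : ℝ} (hP : 0 < P) (he : 0 < e) :
    ∫ r in Set.Ioi (0 : ℝ), r ^ 3 * ((P * r ^ 2 + e)⁻¹) ^ 3 = 1 / (4 * P ^ 2 * e) := by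
  have hpos : ∀ r : ℝ, 0 < P * r ^ 2 + e := fun r => by positivity
  have hd : ∀ r ∈ Set.Ici (0 : ℝ), HasDerivAt
      (fun r : ℝ => (1 / (4 * e * P ^ 2)) * (1 - e * (P * r ^ 2 + e)⁻¹) ^ 2)
      (r ^ 3 * ((P * r ^ 2 + e)⁻¹) ^ 3) r := by
    intro r _
    have h1 : HasDerivAt (fun r : ℝ => P * r ^ 2 + e) (P * (2 * r)) r := by
      simpa using ((hasDerivAt_pow 2 r).const_mul P).add_const e
    have h2 := ((((h1.inv (hpos r).ne').const_mul e).const_sub 1).pow 2).const_mul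
      (1 / (4 * e * P ^ 2))
    refine h2.congr_deriv ?_
    have := (hpos r).ne'
    simp only [Pi.inv_apply, Nat.cast_ofNat, Nat.add_one_sub_one, pow_one]
    field_simp
    ring
  have ht : Filter.Tendsto (fun r : ℝ => (1 / (4 * e * P ^ 2)) * (1 - e * (P * r ^ 2 + e)⁻¹) ^ 2)
      Filter.atTop (nhds ((1 / (4 * e * P ^ 2)) * (1 - e * 0) ^ 2)) := by
    refine Filter.Tendsto.const_mul _ (Filter.Tendsto.pow
      (Filter.Tendsto.const_sub _ (Filter.Tendsto.const_mul _ ?_)) 2)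
    refine Filter.Tendsto.comp tendsto_inv_atTop_zero ?_
    refine Filter.tendsto_atTop_add_const_right _ _ ?_
    exact (Filter.tendsto_pow_atTop (by norm_num)).const_mul_atTop hP
  rw [integral_Ioi_of_hasDerivAt_of_nonneg' hd
    (fun r hr => by have := hpos r; have hr : 0 < r := hr; positivity) ht]
  field_simp
  simp

lemma aux_polar (g : ℝ → ℝ) :
    ∫ x : ℝ × ℝ, g (sq2 x) = 2 * Real.pi * ∫ r in Set.Ioi (0 : ℝ), r * g (r ^ 2) := by
  rw [← integral_comp_polarCoord_symm, polarCoord_target]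
  have h : ∀ p : ℝ × ℝ, p.1 • g (sq2 (polarCoord.symm p)) = (p.1 * g (p.1 ^ 2)) * (1 : ℝ) := by
    intro p
    rw [polarCoord_symm_apply]
    have : sq2 (p.1 * Real.cos p.2, p.1 * Real.sin p.2) = p.1 ^ 2 := by
      simp only [sq2]
      linear_combination p.1 ^ 2 * Real.cos_sq_add_sin_sq p.2
    rw [this]
    simp
  simp_rw [h]
  rw [Measure.volume_eq_prod, setIntegral_prod_mul (fun r : ℝ => r * g (r ^ 2)) (fun _ => (1 : ℝ))]
  simp [Real.pi_pos.le]
  ring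

lemma aux_int_of_bound {P e : ℝ} (hP : 0 < P) (he : 0 < e) (f : ℝ × ℝ → ℝ)
    (hf : Continuous f) (hb : ∀ x, |f x| ≤ 1 + sq2 x) :
    Integrable fun x : ℝ × ℝ => f x * ((P * sq2 x + e)⁻¹) ^ 3 := by
  have h0 : Integrable fun x : ℝ × ℝ => (1 + ‖x‖ ^ 2) ^ (-(4 : ℝ) / 2) :=
    integrable_rpow_neg_one_add_norm_sq (by simp; norm_num)
  set m := min P e with hm
  have hm0 : 0 < m := lt_min hP he
  have hpos : ∀ x, 0 < P * sq2 x + e := fun x => by have := aux_sq2_nonneg x; positivity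
  have hc : Continuous sq2 := by unfold sq2; fun_prop
  refine (h0.const_mul ((m⁻¹) ^ 3)).mono' ?_ ?_
  · refine (hf.mul (Continuous.pow (Continuous.inv₀ (by fun_prop) fun x => (hpos x).ne') 3)).aestronglyMeasurable
  · refine Filter.Eventually.of_forall fun x => ?_
    have hx := aux_sq2_nonneg x
    have hx1 := aux_pos x
    have h1 : m * (1 + sq2 x) ≤ P * sq2 x + e := by
      have h2 : m ≤ P := min_le_left _ _
      have h3 : m ≤ e := min_le_right _ _
      nlinarith
    have h4 : (P * sq2 x + e)⁻¹ ≤ (m * (1 + sq2 x))⁻¹ := inv_anti₀ (by positivity) h1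
    have h5 : ‖x‖ ^ 2 ≤ sq2 x := by
      rw [Prod.norm_def]
      unfold sq2
      rcases max_choice ‖x.1‖ ‖x.2‖ with h | h <;> rw [h] <;> simp [sq_nonneg]
    have h6 : (1 + ‖x‖ ^ 2) ^ (-(4 : ℝ) / 2) = ((1 + ‖x‖ ^ 2)⁻¹) ^ 2 := by
      rw [show (-(4 : ℝ) / 2) = -((2 : ℕ) : ℝ) by norm_num, Real.rpow_neg (by positivity),
        Real.rpow_natCast, inv_pow]
    rw [h6, norm_mul, Real.norm_eq_abs, Real.norm_eq_abs,
      abs_of_nonneg (pow_nonneg (inv_nonneg.2 (hpos x).le) 3)]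
    have h7 : (1 + sq2 x)⁻¹ ≤ (1 + ‖x‖ ^ 2)⁻¹ := inv_anti₀ (by positivity) (by linarith)
    calc |f x| * ((P * sq2 x + e)⁻¹) ^ 3
        ≤ (1 + sq2 x) * ((m * (1 + sq2 x))⁻¹) ^ 3 := by
          have := inv_nonneg.2 (hpos x).le
          gcongr
          exact hb x
      _ = (m⁻¹) ^ 3 * ((1 + sq2 x)⁻¹) ^ 2 := by field_simp
      _ ≤ _ := by
          have := inv_nonneg.2 hx1.le
          gcongr

lemma aux_lin4 {f0 f1 f2 f3 : ℝ × ℝ → ℝ} (i0 : Integrable f0) (i1 : Integrable f1)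
    (i2 : Integrable f2) (i3 : Integrable f3) (k0 k1 k2 k3 : ℝ) :
    Integrable (fun x => k0 * f0 x + k1 * f1 x + k2 * f2 x + k3 * f3 x) ∧
    ∫ x, (k0 * f0 x + k1 * f1 x + k2 * f2 x + k3 * f3 x)
      = k0 * (∫ x, f0 x) + k1 * (∫ x, f1 x) + k2 * (∫ x, f2 x) + k3 * (∫ x, f3 x) := by
  have j0 := i0.const_mul k0
  have j1 := i1.const_mul k1
  have j2 := i2.const_mul k2
  have j3 := i3.const_mul k3
  have j01 : Integrable fun x => k0 * f0 x + k1 * f1 x := j0.add j1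
  have j012 : Integrable fun x => k0 * f0 x + k1 * f1 x + k2 * f2 x := j01.add j2
  refine ⟨j012.add j3, ?_⟩
  rw [integral_add j012 j3, integral_add j01 j2, integral_add j0 j1,
    integral_const_mul, integral_const_mul, integral_const_mul, integral_const_mul]

/-- Integral of a quadratic polynomial against the kernel, centered case. -/
lemma aux_centered {P : ℝ} (hP : 0 < P) (k0 k1 k2 k3 : ℝ) :
    Integrable (fun x : ℝ × ℝ =>
      (k0 + k1 * x.1 + k2 * x.2 + k3 * sq2 x) * ((P * sq2 x + P⁻¹)⁻¹) ^ 3) ∧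
    ∫ x : ℝ × ℝ, (k0 + k1 * x.1 + k2 * x.2 + k3 * sq2 x) * ((P * sq2 x + P⁻¹)⁻¹) ^ 3
      = Real.pi * (k0 * P / 2 + k3 / (2 * P)) := by
  have hPi : 0 < P⁻¹ := inv_pos.2 hP
  have hc : Continuous sq2 := by unfold sq2; fun_prop
  have i0 : Integrable fun x : ℝ × ℝ => (1 : ℝ) * ((P * sq2 x + P⁻¹)⁻¹) ^ 3 :=
    aux_int_of_bound hP hPi (fun _ => 1) (by fun_prop)
      (fun x => by simpa using aux_sq2_nonneg x)
  have i1 : Integrable fun x : ℝ × ℝ => x.1 * ((P * sq2 x + P⁻¹)⁻¹) ^ 3 :=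
    aux_int_of_bound hP hPi (fun x => x.1) (by fun_prop)
      (fun x => by unfold sq2; rw [abs_le]; constructor <;> nlinarith [sq_nonneg (x.1 - 1), sq_nonneg (x.1 + 1), sq_nonneg x.2, sq_nonneg x.1])
  have i2 : Integrable fun x : ℝ × ℝ => x.2 * ((P * sq2 x + P⁻¹)⁻¹) ^ 3 :=
    aux_int_of_bound hP hPi (fun x => x.2) (by fun_prop)
      (fun x => by unfold sq2; rw [abs_le]; constructor <;> nlinarith [sq_nonneg (x.2 - 1), sq_nonneg (x.2 + 1), sq_nonneg x.2, sq_nonneg x.1])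
  have i3 : Integrable fun x : ℝ × ℝ => sq2 x * ((P * sq2 x + P⁻¹)⁻¹) ^ 3 :=
    aux_int_of_bound hP hPi (fun x => sq2 x) (by fun_prop)
      (fun x => by rw [abs_of_nonneg (aux_sq2_nonneg x)]; linarith)
  have hsq : ∀ x : ℝ × ℝ, sq2 (-x) = sq2 x := fun x => by simp [sq2]
  have v0 : ∫ x : ℝ × ℝ, (1 : ℝ) * ((P * sq2 x + P⁻¹)⁻¹) ^ 3 = Real.pi * (P / 2) := by
    rw [aux_polar (fun s => (1 : ℝ) * ((P * s + P⁻¹)⁻¹) ^ 3)]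
    simp only [one_mul]
    rw [aux_radial1 hP hPi]
    field_simp
    norm_num
  have v1 : ∫ x : ℝ × ℝ, x.1 * ((P * sq2 x + P⁻¹)⁻¹) ^ 3 = 0 := by
    have h := integral_neg_eq_self (fun x : ℝ × ℝ => x.1 * ((P * sq2 x + P⁻¹)⁻¹) ^ 3) volume
    simp only [hsq, Prod.fst_neg, neg_mul, integral_neg] at h
    linarith
  have v2 : ∫ x : ℝ × ℝ, x.2 * ((P * sq2 x + P⁻¹)⁻¹) ^ 3 = 0 := by
    have h := integral_neg_eq_self (fun x : ℝ × ℝ => x.2 * ((P * sq2 x + P⁻¹)⁻¹) ^ 3) volume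
    simp only [hsq, Prod.snd_neg, neg_mul, integral_neg] at h
    linarith
  have v3 : ∫ x : ℝ × ℝ, sq2 x * ((P * sq2 x + P⁻¹)⁻¹) ^ 3 = Real.pi * (1 / (2 * P)) := by
    rw [aux_polar (fun s => s * ((P * s + P⁻¹)⁻¹) ^ 3)]
    have : ∀ r : ℝ, r * (r ^ 2 * ((P * r ^ 2 + P⁻¹)⁻¹) ^ 3) = r ^ 3 * ((P * r ^ 2 + P⁻¹)⁻¹) ^ 3 :=
      fun r => by ring
    simp only [this]
    rw [aux_radial3 hP hPi]
    field_simp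
    norm_num
  have hfun : (fun x : ℝ × ℝ =>
      (k0 + k1 * x.1 + k2 * x.2 + k3 * sq2 x) * ((P * sq2 x + P⁻¹)⁻¹) ^ 3) = fun x : ℝ × ℝ =>
      k0 * ((1 : ℝ) * ((P * sq2 x + P⁻¹)⁻¹) ^ 3) + k1 * (x.1 * ((P * sq2 x + P⁻¹)⁻¹) ^ 3)
      + k2 * (x.2 * ((P * sq2 x + P⁻¹)⁻¹) ^ 3) + k3 * (sq2 x * ((P * sq2 x + P⁻¹)⁻¹) ^ 3) := by
    funext x; ring
  obtain ⟨l1, l2⟩ := aux_lin4 i0 i1 i2 i3 k0 k1 k2 k3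
  rw [hfun]
  refine ⟨l1, ?_⟩
  rw [l2, v0, v1, v2, v3]
  field_simp
  ring

/-- Integral of a quadratic polynomial against the kernel, general case. -/
lemma aux_general {P Q s t : ℝ} (hP : 0 < P) (hdet : P * Q - s ^ 2 - t ^ 2 = 1)
    (k0 k1 k2 k3 : ℝ) :
    Integrable (fun x : ℝ × ℝ => (k0 + k1 * x.1 + k2 * x.2 + k3 * sq2 x) *
      ((P * sq2 x + 2 * (s * x.1 + t * x.2) + Q)⁻¹) ^ 3) ∧
    ∫ x : ℝ × ℝ, (k0 + k1 * x.1 + k2 * x.2 + k3 * sq2 x) *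
      ((P * sq2 x + 2 * (s * x.1 + t * x.2) + Q)⁻¹) ^ 3
      = Real.pi * ((k0 * P - k1 * s - k2 * t + k3 * Q) / 2) := by
  set v : ℝ × ℝ := (s / P, t / P) with hv
  have hQ : Q = (1 + s ^ 2 + t ^ 2) / P := by field_simp; linarith
  obtain ⟨h1, h2⟩ := aux_centered hP
    (k0 - k1 * (s / P) - k2 * (t / P) + k3 * ((s / P) ^ 2 + (t / P) ^ 2))
    (k1 - 2 * k3 * (s / P)) (k2 - 2 * k3 * (t / P)) k3
  have hfun : (fun x : ℝ × ℝ => (k0 + k1 * x.1 + k2 * x.2 + k3 * sq2 x) *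
      ((P * sq2 x + 2 * (s * x.1 + t * x.2) + Q)⁻¹) ^ 3) = fun x => 
      (fun x : ℝ × ℝ => (k0 - k1 * (s / P) - k2 * (t / P) + k3 * ((s / P) ^ 2 + (t / P) ^ 2) +
      (k1 - 2 * k3 * (s / P)) * x.1 + (k2 - 2 * k3 * (t / P)) * x.2 + k3 * sq2 x) *
       ((P * sq2 x + P⁻¹)⁻¹) ^ 3) (x + v) := by
    funext x
    have e1 : P * sq2 x + 2 * (s * x.1 + t * x.2) + Q = P * sq2 (x + v) + P⁻¹ := by
      simp only [sq2, hv, Prod.fst_add, Prod.snd_add]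
      rw [hQ]
      field_simp
      ring
    simp only [e1]
    congr 1
    simp only [sq2, hv, Prod.fst_add, Prod.snd_add]
    ring
  rw [hfun]
  refine ⟨h1.comp_add_right v, ?_⟩
  have h3 := integral_add_right_eq_self (μ := (volume : Measure (ℝ × ℝ)))
    (fun x : ℝ × ℝ => (k0 - k1 * (s / P) - k2 * (t / P) + k3 * ((s / P) ^ 2 + (t / P) ^ 2) +
      (k1 - 2 * k3 * (s / P)) * x.1 + (k2 - 2 * k3 * (t / P)) * x.2 + k3 * sq2 x) *
       ((P * sq2 x + P⁻¹)⁻¹) ^ 3) v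
  refine h3.trans ?_
  rw [h2, hQ]
  field_simp
  ring

lemma aux_det (A : SL2C) : A.1 0 0 * A.1 1 1 - A.1 0 1 * A.1 1 0 = 1 := by
  have h := A.2
  rw [Matrix.det_fin_two] at h
  exact h

/-- Real coefficients of the Hermitian form `A^* A`. -/
noncomputable def auxP (A : SL2C) : ℝ := Complex.normSq (A.1 0 0) + Complex.normSq (A.1 1 0)
noncomputable def auxQ (A : SL2C) : ℝ := Complex.normSq (A.1 0 1) + Complex.normSq (A.1 1 1)
noncomputable def auxS (A : SL2C) : ℝ := (A.1 0 0).re * (A.1 0 1).re + (A.1 0 0).im * (A.1 0 1).im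
  + ((A.1 1 0).re * (A.1 1 1).re + (A.1 1 0).im * (A.1 1 1).im)
noncomputable def auxT (A : SL2C) : ℝ := (A.1 0 0).re * (A.1 0 1).im - (A.1 0 0).im * (A.1 0 1).re
  + ((A.1 1 0).re * (A.1 1 1).im - (A.1 1 0).im * (A.1 1 1).re)

lemma aux_det_re (A : SL2C) :
    (A.1 0 0).re * (A.1 1 1).re - (A.1 0 0).im * (A.1 1 1).im
      - ((A.1 0 1).re * (A.1 1 0).re - (A.1 0 1).im * (A.1 1 0).im) = 1 := by
  simpa using congrArg Complex.re (aux_det A)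

lemma aux_det_im (A : SL2C) :
    (A.1 0 0).re * (A.1 1 1).im + (A.1 0 0).im * (A.1 1 1).re
      - ((A.1 0 1).re * (A.1 1 0).im + (A.1 0 1).im * (A.1 1 0).re) = 0 := by
  simpa using congrArg Complex.im (aux_det A)

lemma aux_hdet (A : SL2C) : auxP A * auxQ A - auxS A ^ 2 - auxT A ^ 2 = 1 := by
  have h1 := aux_det_re A
  have h2 := aux_det_im A
  have h3 : auxP A * auxQ A - auxS A ^ 2 - auxT A ^ 2 =
    ((A.1 0 0).re * (A.1 1 1).re - (A.1 0 0).im * (A.1 1 1).im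
      - ((A.1 0 1).re * (A.1 1 0).re - (A.1 0 1).im * (A.1 1 0).im)) ^ 2 +
    ((A.1 0 0).re * (A.1 1 1).im + (A.1 0 0).im * (A.1 1 1).re
      - ((A.1 0 1).re * (A.1 1 0).im + (A.1 0 1).im * (A.1 1 0).re)) ^ 2 := by
    simp only [auxP, auxQ, auxS, auxT, Complex.normSq_apply]
    ring
  rw [h3, h1, h2]
  norm_num

lemma aux_P_nonneg (A : SL2C) : 0 ≤ auxP A :=
  add_nonneg (Complex.normSq_nonneg _) (Complex.normSq_nonneg _)

lemma aux_Q_nonneg (A : SL2C) : 0 ≤ auxQ A :=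
  add_nonneg (Complex.normSq_nonneg _) (Complex.normSq_nonneg _)

lemma aux_P_pos (A : SL2C) : 0 < auxP A := by
  rcases (aux_P_nonneg A).lt_or_eq with h | h
  · exact h
  · have := aux_hdet A
    rw [← h] at this
    nlinarith [sq_nonneg (auxS A), sq_nonneg (auxT A)]

/-- Half the trace of the Hermitian form. -/
noncomputable def auxp (A : SL2C) : ℝ := (auxP A + auxQ A) / 2

lemma aux_p_pos (A : SL2C) : 0 < auxp A := by
  have := aux_P_pos A
  have := aux_Q_nonneg A
  unfold auxp
  linarith

lemma aux_den (A : SL2C) (x : ℝ × ℝ) :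
    Complex.normSq (A.1 0 0 * cx x + A.1 0 1) + Complex.normSq (A.1 1 0 * cx x + A.1 1 1)
      = auxP A * sq2 x + 2 * (auxS A * x.1 + auxT A * x.2) + auxQ A := by
  simp only [auxP, auxQ, auxS, auxT, Complex.normSq_apply, sq2, cx, Complex.add_re, Complex.add_im,
    Complex.mul_re, Complex.mul_im]
  ring

lemma aux_jac (A : SL2C) (x : ℝ × ℝ) :
    jacA A (SPinv x) ^ (3 / 2 : ℝ) = (1 + sq2 x) ^ 3 *
      ((auxP A * sq2 x + 2 * (auxS A * x.1 + auxT A * x.2) + auxQ A)⁻¹) ^ 3 := by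
  unfold jacA
  rw [if_neg (aux_SPinv_ne x), aux_SP_SPinv, ← aux_den]
  have h1 : Complex.normSq (cx x) = sq2 x := by
    simp only [Complex.normSq_apply, cx, sq2]; ring
  rw [h1]
  have h2 : 0 ≤ (1 + sq2 x) / (Complex.normSq (A.1 0 0 * cx x + A.1 0 1) +
      Complex.normSq (A.1 1 0 * cx x + A.1 1 1)) :=
    div_nonneg (aux_pos x).le (add_nonneg (Complex.normSq_nonneg _) (Complex.normSq_nonneg _))
  rw [← Real.rpow_natCast, ← Real.rpow_mul h2,
    show ((2 : ℕ) : ℝ) * (3 / 2) = ((3 : ℕ) : ℝ) by norm_num, Real.rpow_natCast, div_eq_mul_inv,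
    mul_pow]

lemma aux_mass (A : SL2C) : massA A = auxp A := by
  unfold massA sphInt
  have h : ∀ x : ℝ × ℝ, ((1 + sq2 x)⁻¹) ^ 2 • jacA A (SPinv x) ^ (3 / 2 : ℝ) =
      (1 + 0 * x.1 + 0 * x.2 + 1 * sq2 x) *
      ((auxP A * sq2 x + 2 * (auxS A * x.1 + auxT A * x.2) + auxQ A)⁻¹) ^ 3 := by
    intro x
    rw [aux_jac, smul_eq_mul]
    have := (aux_pos x).ne'
    field_simp
    ring
  simp_rw [h]
  rw [(aux_general (aux_P_pos A) (aux_hdet A) 1 0 0 1).2]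
  have := Real.pi_ne_zero
  simp only [smul_eq_mul, auxp]
  field_simp
  ring

lemma aux_sphInt_apply (f : (Fin 3 → ℝ) → Fin 3 → ℝ)
    (hf : ∀ i, Integrable fun x : ℝ × ℝ => ((1 + sq2 x)⁻¹) ^ 2 * f (SPinv x) i) (i : Fin 3) :
    sphInt f i = (1 / Real.pi) * ∫ x : ℝ × ℝ, ((1 + sq2 x)⁻¹) ^ 2 * f (SPinv x) i := by
  unfold sphInt
  rw [Pi.smul_apply, smul_eq_mul, eval_integral]
  · rfl
  · exact hf

lemma aux_com (A : SL2C) : comA A 0 = - auxS A / auxp A ∧ comA A 1 = - auxT A / auxp A ∧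
    comA A 2 = - ((auxP A - auxQ A) / 2) / auxp A := by
  have h : ∀ i : Fin 3, ∃ k0 k1 k2 k3 : ℝ, (k0 * auxP A - k1 * auxS A - k2 * auxT A + k3 * auxQ A) / 2
      = ![-auxS A, -auxT A, -((auxP A - auxQ A) / 2)] i ∧ ∀ x : ℝ × ℝ,
      ((1 + sq2 x)⁻¹) ^ 2 * (jacA A (SPinv x) ^ (3 / 2 : ℝ) • SPinv x) i =
      (k0 + k1 * x.1 + k2 * x.2 + k3 * sq2 x) *
      ((auxP A * sq2 x + 2 * (auxS A * x.1 + auxT A * x.2) + auxQ A)⁻¹) ^ 3 := by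
    intro i
    fin_cases i
    · refine ⟨0, 2, 0, 0, by simp; ring, fun x => ?_⟩
      have := (aux_pos x).ne'
      simp only [Fin.zero_eta, Pi.smul_apply, smul_eq_mul, aux_jac, aux_SPinv0]
      field_simp
      ring
    · refine ⟨0, 0, 2, 0, by simp; ring, fun x => ?_⟩
      have := (aux_pos x).ne'
      simp only [Fin.mk_one, Pi.smul_apply, smul_eq_mul, aux_jac, aux_SPinv1]
      field_simp
      ring
    · refine ⟨-1, 0, 0, 1, by simp; ring, fun x => ?_⟩
      have := (aux_pos x).ne'
      simp only [Fin.reduceFinMk, Pi.smul_apply, smul_eq_mul, aux_jac, aux_SPinv2]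
      field_simp
      ring
  have key : ∀ i, comA A i = ![-auxS A, -auxT A, -((auxP A - auxQ A) / 2)] i / auxp A := by
    intro i
    unfold comA
    rw [aux_mass, Pi.smul_apply, aux_sphInt_apply]
    · obtain ⟨k0, k1, k2, k3, e1, e2⟩ := h i
      simp_rw [e2]
      rw [(aux_general (aux_P_pos A) (aux_hdet A) k0 k1 k2 k3).2, e1]
      have := Real.pi_ne_zero
      have := (aux_p_pos A).ne'
      rw [smul_eq_mul]
      field_simp
    · intro j
      obtain ⟨k0, k1, k2, k3, e1, e2⟩ := h j
      simp_rw [e2]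
      exact (aux_general (aux_P_pos A) (aux_hdet A) k0 k1 k2 k3).1
  exact ⟨key 0, key 1, key 2⟩

/-- Homogeneous coordinates of the preimage. -/
noncomputable def auxW1 (A : SL2C) (x : ℝ × ℝ) : ℂ := A.1 1 1 * cx x - A.1 0 1
noncomputable def auxW2 (A : SL2C) (x : ℝ × ℝ) : ℂ := A.1 0 0 - A.1 1 0 * cx x
noncomputable def auxN (A : SL2C) (x : ℝ × ℝ) : ℝ :=
  Complex.normSq (auxW1 A x) + Complex.normSq (auxW2 A x)
noncomputable def auxV (A : SL2C) (x : ℝ × ℝ) : Fin 3 → ℝ :=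
  ![2 * ((auxW1 A x).re * (auxW2 A x).re + (auxW1 A x).im * (auxW2 A x).im),
    2 * ((auxW1 A x).im * (auxW2 A x).re - (auxW1 A x).re * (auxW2 A x).im),
    Complex.normSq (auxW1 A x) - Complex.normSq (auxW2 A x)]

lemma aux_form (A : SL2C) (x : ℝ × ℝ) :
    auxp A * auxN A x + auxS A * auxV A x 0 + auxT A * auxV A x 1
      + (auxP A - auxQ A) / 2 * auxV A x 2 = 1 + sq2 x := by
  have h1 : A.1 0 0 * auxW1 A x + A.1 0 1 * auxW2 A x = cx x := by
    unfold auxW1 auxW2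
    linear_combination cx x * aux_det A
  have h2 : A.1 1 0 * auxW1 A x + A.1 1 1 * auxW2 A x = 1 := by
    unfold auxW1 auxW2
    linear_combination aux_det A
  have h3 : 1 + sq2 x = Complex.normSq (A.1 0 0 * auxW1 A x + A.1 0 1 * auxW2 A x) +
      Complex.normSq (A.1 1 0 * auxW1 A x + A.1 1 1 * auxW2 A x) := by
    rw [h1, h2]
    simp only [Complex.normSq_apply, cx, sq2, Complex.one_re, Complex.one_im]
    ring
  rw [h3]
  simp only [auxp, auxN, auxV, auxP, auxQ, auxS, auxT, Complex.normSq_apply, Complex.add_re,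
    Complex.add_im, Complex.mul_re, Complex.mul_im, Matrix.cons_val_zero, Matrix.cons_val_one,
    Matrix.cons_val]
  ring

lemma aux_N_pos (A : SL2C) (x : ℝ × ℝ) : 0 < auxN A x := by
  have h0 : 0 ≤ auxN A x := add_nonneg (Complex.normSq_nonneg _) (Complex.normSq_nonneg _)
  rcases h0.lt_or_eq with h | h
  · exact h
  · exfalso
    have n1 := Complex.normSq_nonneg (auxW1 A x)
    have n2 := Complex.normSq_nonneg (auxW2 A x)
    have e1 : Complex.normSq (auxW1 A x) = 0 := by unfold auxN at h; linarith
    have e2 : Complex.normSq (auxW2 A x) = 0 := by unfold auxN at h; linarith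
    have f1 := Complex.normSq_eq_zero.1 e1
    have f2 := Complex.normSq_eq_zero.1 e2
    have hf := aux_form A x
    have := aux_pos x
    simp [auxN, auxV, f1, f2] at hf
    linarith

lemma aux_tau (A : SL2C) (x : ℝ × ℝ) :
    tauA A⁻¹ (SPinv x) = fun i => auxV A x i / auxN A x := by
  have hN := (aux_N_pos A x).ne'
  have i00 : (A⁻¹).1 0 0 = A.1 1 1 := by
    rw [Matrix.SpecialLinearGroup.coe_inv, Matrix.adjugate_fin_two]; rfl
  have i01 : (A⁻¹).1 0 1 = - A.1 0 1 := by
    rw [Matrix.SpecialLinearGroup.coe_inv, Matrix.adjugate_fin_two]; rfl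
  have i10 : (A⁻¹).1 1 0 = - A.1 1 0 := by
    rw [Matrix.SpecialLinearGroup.coe_inv, Matrix.adjugate_fin_two]; rfl
  have i11 : (A⁻¹).1 1 1 = A.1 0 0 := by
    rw [Matrix.SpecialLinearGroup.coe_inv, Matrix.adjugate_fin_two]; rfl
  have w1 : A.1 1 1 * cx x + - A.1 0 1 = auxW1 A x := by unfold auxW1; ring
  have w2 : - A.1 1 0 * cx x + A.1 0 0 = auxW2 A x := by unfold auxW2; ring
  unfold tauA TA
  rw [if_neg (aux_SPinv_ne x), aux_SP_SPinv, i00, i01, i10, i11, w1, w2]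
  split_ifs with h
  · have hn : auxN A x = Complex.normSq (auxW1 A x) := by simp [auxN, h]
    rw [hn] at hN ⊢
    funext i
    fin_cases i <;> simp [northPole, auxV, h, div_self hN]
  · have hn : Complex.normSq (auxW2 A x) ≠ 0 := fun hh => h (Complex.normSq_eq_zero.1 hh)
    have hre : (auxW1 A x / auxW2 A x).re = ((auxW1 A x).re * (auxW2 A x).re
        + (auxW1 A x).im * (auxW2 A x).im) / Complex.normSq (auxW2 A x) := by
      rw [Complex.div_re]; ring
    have him : (auxW1 A x / auxW2 A x).im = ((auxW1 A x).im * (auxW2 A x).re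
        - (auxW1 A x).re * (auxW2 A x).im) / Complex.normSq (auxW2 A x) := by
      rw [Complex.div_im]; ring
    have hsq : sq2 (uncx (auxW1 A x / auxW2 A x)) =
        Complex.normSq (auxW1 A x) / Complex.normSq (auxW2 A x) := by
      rw [← Complex.normSq_div]
      simp only [sq2, uncx, Complex.normSq_apply]
      ring
    have hden : 1 + Complex.normSq (auxW1 A x) / Complex.normSq (auxW2 A x) =
        auxN A x / Complex.normSq (auxW2 A x) := by
      unfold auxN
      field_simp
      ring
    funext i
    fin_cases i
    · simp only [Fin.zero_eta, aux_SPinv0, hsq, hden, auxV, Matrix.cons_val_zero]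
      simp only [uncx, hre]
      field_simp
    · simp only [Fin.mk_one, aux_SPinv1, hsq, hden, auxV, Matrix.cons_val_one]
      simp only [uncx, him]
      field_simp
      try simp
    · simp only [Fin.reduceFinMk, aux_SPinv2, hsq, hden, auxV, Matrix.cons_val]
      field_simp

lemma aux_weight (A : SL2C) (x : ℝ × ℝ) :
    (1 - dot3 (comA A) (tauA A⁻¹ (SPinv x)))⁻¹ = auxp A * auxN A x / (1 + sq2 x) := by
  have hN := (aux_N_pos A x).ne'
  have hp := (aux_p_pos A).ne'
  obtain ⟨c0, c1, c2⟩ := aux_com A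
  have : 1 - dot3 (comA A) (tauA A⁻¹ (SPinv x)) = (1 + sq2 x) / (auxp A * auxN A x) := by
    rw [← aux_form A x, aux_tau]
    simp only [dot3, c0, c1, c2]
    field_simp
    ring
  rw [this, inv_div]

lemma aux_int_h (g f : ℝ × ℝ → ℝ) (hg : Integrable g) (hf : Continuous f)
    (hb : ∀ x, |f x| ≤ 1 + sq2 x) :
    Integrable fun x : ℝ × ℝ => f x * (g x / (1 + sq2 x)) := by
  have hc : Continuous sq2 := by unfold sq2; fun_prop
  have hc2 : Continuous fun x : ℝ × ℝ => f x / (1 + sq2 x) :=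
    hf.div (by fun_prop) fun x => (aux_pos x).ne'
  have h : (fun x : ℝ × ℝ => f x * (g x / (1 + sq2 x))) = fun x => (f x / (1 + sq2 x)) * g x := by
    funext x; ring
  rw [h]
  refine hg.bdd_mul (c := 1) hc2.aestronglyMeasurable (Filter.Eventually.of_forall fun x => ?_)
  rw [Real.norm_eq_abs, abs_div, abs_of_pos (aux_pos x), div_le_one (aux_pos x)]
  exact hb x

/-- Real coefficients of the time component. -/
lemma aux_N_expand (A : SL2C) (x : ℝ × ℝ) : auxN A x =
    (Complex.normSq (A.1 0 1) + Complex.normSq (A.1 0 0)) * 1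
    + (-2 * ((A.1 1 1).re * (A.1 0 1).re + (A.1 1 1).im * (A.1 0 1).im
        + (A.1 1 0).re * (A.1 0 0).re + (A.1 1 0).im * (A.1 0 0).im)) * x.1
    + (-2 * ((A.1 1 1).re * (A.1 0 1).im - (A.1 1 1).im * (A.1 0 1).re
        + (A.1 1 0).re * (A.1 0 0).im - (A.1 1 0).im * (A.1 0 0).re)) * x.2
    + (Complex.normSq (A.1 1 1) + Complex.normSq (A.1 1 0)) * sq2 x := by
  simp only [auxN, auxW1, auxW2, cx, sq2, Complex.normSq_apply, Complex.sub_re,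
    Complex.sub_im, Complex.mul_re, Complex.mul_im]
  ring

lemma aux_V2_expand (A : SL2C) (x : ℝ × ℝ) : auxV A x 2 =
    (Complex.normSq (A.1 0 1) - Complex.normSq (A.1 0 0)) * 1
    + (-2 * ((A.1 1 1).re * (A.1 0 1).re + (A.1 1 1).im * (A.1 0 1).im
        - (A.1 1 0).re * (A.1 0 0).re - (A.1 1 0).im * (A.1 0 0).im)) * x.1
    + (-2 * ((A.1 1 1).re * (A.1 0 1).im - (A.1 1 1).im * (A.1 0 1).re
        - (A.1 1 0).re * (A.1 0 0).im + (A.1 1 0).im * (A.1 0 0).re)) * x.2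
    + (Complex.normSq (A.1 1 1) - Complex.normSq (A.1 1 0)) * sq2 x := by
  simp only [auxV, auxW1, auxW2, cx, sq2, Complex.normSq_apply, Complex.sub_re,
    Complex.sub_im, Complex.mul_re, Complex.mul_im, Matrix.cons_val]
  ring

lemma aux_V0_expand (A : SL2C) (x : ℝ × ℝ) : auxV A x 0 =
    (-2 * ((A.1 0 1).re * (A.1 0 0).re + (A.1 0 1).im * (A.1 0 0).im)) * 1
    + (2 * ((A.1 1 1).re * (A.1 0 0).re + (A.1 1 1).im * (A.1 0 0).im
        + (A.1 0 1).re * (A.1 1 0).re + (A.1 0 1).im * (A.1 1 0).im)) * x.1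
    + (2 * ((A.1 1 1).re * (A.1 0 0).im - (A.1 1 1).im * (A.1 0 0).re
        - (A.1 0 1).re * (A.1 1 0).im + (A.1 0 1).im * (A.1 1 0).re)) * x.2
    + (-2 * ((A.1 1 1).re * (A.1 1 0).re + (A.1 1 1).im * (A.1 1 0).im)) * sq2 x := by
  simp only [auxV, auxW1, auxW2, cx, sq2, Complex.sub_re,
    Complex.sub_im, Complex.mul_re, Complex.mul_im, Matrix.cons_val_zero]
  ring

lemma aux_V1_expand (A : SL2C) (x : ℝ × ℝ) : auxV A x 1 =
    (-2 * ((A.1 0 1).im * (A.1 0 0).re - (A.1 0 1).re * (A.1 0 0).im)) * 1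
    + (2 * ((A.1 1 1).im * (A.1 0 0).re - (A.1 1 1).re * (A.1 0 0).im
        + (A.1 0 1).im * (A.1 1 0).re - (A.1 0 1).re * (A.1 1 0).im)) * x.1
    + (2 * ((A.1 1 1).re * (A.1 0 0).re + (A.1 1 1).im * (A.1 0 0).im
        - (A.1 0 1).re * (A.1 1 0).re - (A.1 0 1).im * (A.1 1 0).im)) * x.2
    + (-2 * ((A.1 1 1).im * (A.1 1 0).re - (A.1 1 1).re * (A.1 1 0).im)) * sq2 x := by
  simp only [auxV, auxW1, auxW2, cx, sq2, Complex.sub_re,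
    Complex.sub_im, Complex.mul_re, Complex.mul_im, Matrix.cons_val_one, Matrix.cons_val_zero]
  ring

/-- Every component integral is a linear combination of the four basic moments. -/
lemma aux_moment {F : ℝ × ℝ → ℝ} {h : ℝ × ℝ → ℝ} {k0 k1 k2 k3 : ℝ}
    (i0 : Integrable fun x : ℝ × ℝ => 1 * h x) (i1 : Integrable fun x : ℝ × ℝ => x.1 * h x)
    (i2 : Integrable fun x : ℝ × ℝ => x.2 * h x) (i3 : Integrable fun x : ℝ × ℝ => sq2 x * h x)
    (hF : ∀ x, F x = (k0 * 1 + k1 * x.1 + k2 * x.2 + k3 * sq2 x) * h x) :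
    Integrable F ∧ ∫ x, F x = k0 * (∫ x, 1 * h x) + k1 * (∫ x : ℝ × ℝ, x.1 * h x)
      + k2 * (∫ x : ℝ × ℝ, x.2 * h x) + k3 * (∫ x, sq2 x * h x) := by
  have e : F = fun x => k0 * (1 * h x) + k1 * (x.1 * h x) + k2 * (x.2 * h x)
      + k3 * (sq2 x * h x) := by
    funext x; rw [hF]; ring
  rw [e]
  exact aux_lin4 i0 i1 i2 i3 k0 k1 k2 k3

/-- invariance of the Lorentzian quantity
`(∫ e^{2u})² − |∫ ω e^{2u}|²` under the conformal change involving `τ⁻¹` and `a_τ`. -/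
theorem lorentzian_invariance (A : SL2C) (u : (Fin 3 → ℝ) → ℝ) (hu : Measurable u)
    (hint : SphIntegrable fun ω => Real.exp (2 * u ω)) :
    (sphInt fun ω => Real.exp (2 * u ω)) ^ 2 -
        norm3sq (sphInt fun ω => Real.exp (2 * u ω) • ω)
      = (1 - norm3sq (comA A)) *
        ((sphInt fun ω => (1 - dot3 (comA A) (tauA A⁻¹ ω))⁻¹ * Real.exp (2 * u ω)) ^ 2 -
          norm3sq (sphInt fun ω =>
            ((1 - dot3 (comA A) (tauA A⁻¹ ω))⁻¹ * Real.exp (2 * u ω)) • tauA A⁻¹ ω)) := by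
  have hcont : Continuous sq2 := by unfold sq2; fun_prop
  set g : ℝ × ℝ → ℝ := fun x => ((1 + sq2 x)⁻¹) ^ 2 * Real.exp (2 * u (SPinv x)) with hg
  have hgi : Integrable g := hint
  set h : ℝ × ℝ → ℝ := fun x => g x / (1 + sq2 x) with hh
  have i0 : Integrable fun x : ℝ × ℝ => 1 * h x :=
    aux_int_h g (fun _ => 1) hgi (by fun_prop) (fun x => by simpa using aux_sq2_nonneg x)
  have i1 : Integrable fun x : ℝ × ℝ => x.1 * h x :=
    aux_int_h g (fun x => x.1) hgi (by fun_prop)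
      (fun x => by
        unfold sq2; rw [abs_le]
        constructor <;> nlinarith [sq_nonneg (x.1 - 1), sq_nonneg (x.1 + 1), sq_nonneg x.2,
          sq_nonneg x.1])
  have i2 : Integrable fun x : ℝ × ℝ => x.2 * h x :=
    aux_int_h g (fun x => x.2) hgi (by fun_prop)
      (fun x => by
        unfold sq2; rw [abs_le]
        constructor <;> nlinarith [sq_nonneg (x.2 - 1), sq_nonneg (x.2 + 1), sq_nonneg x.2,
          sq_nonneg x.1])
  have i3 : Integrable fun x : ℝ × ℝ => sq2 x * h x :=
    aux_int_h g sq2 hgi (by fun_prop)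
      (fun x => by rw [abs_of_nonneg (aux_sq2_nonneg x)]; linarith)
  have hp := (aux_p_pos A).ne'
  -- left-hand side
  have L : ∀ x : ℝ × ℝ, ((1 + sq2 x)⁻¹) ^ 2 • Real.exp (2 * u (SPinv x)) =
      (1 * 1 + 0 * x.1 + 0 * x.2 + 1 * sq2 x) * h x := by
    intro x
    have := (aux_pos x).ne'
    simp only [hh, hg, smul_eq_mul]
    field_simp
    ring
  have L0 : ∀ x : ℝ × ℝ, ((1 + sq2 x)⁻¹) ^ 2 * (Real.exp (2 * u (SPinv x)) • SPinv x) 0 =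
      (0 * 1 + 2 * x.1 + 0 * x.2 + 0 * sq2 x) * h x := by
    intro x
    have := (aux_pos x).ne'
    simp only [hh, hg, Pi.smul_apply, smul_eq_mul, aux_SPinv0]
    field_simp
    ring
  have L1 : ∀ x : ℝ × ℝ, ((1 + sq2 x)⁻¹) ^ 2 * (Real.exp (2 * u (SPinv x)) • SPinv x) 1 =
      (0 * 1 + 0 * x.1 + 2 * x.2 + 0 * sq2 x) * h x := by
    intro x
    have := (aux_pos x).ne'
    simp only [hh, hg, Pi.smul_apply, smul_eq_mul, aux_SPinv1]
    field_simp
    ring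
  have L2 : ∀ x : ℝ × ℝ, ((1 + sq2 x)⁻¹) ^ 2 * (Real.exp (2 * u (SPinv x)) • SPinv x) 2 =
      ((-1) * 1 + 0 * x.1 + 0 * x.2 + 1 * sq2 x) * h x := by
    intro x
    have := (aux_pos x).ne'
    simp only [hh, hg, Pi.smul_apply, smul_eq_mul, aux_SPinv2]
    field_simp
    ring
  -- right-hand side
  have R : ∀ x : ℝ × ℝ, (auxp A)⁻¹ * (((1 + sq2 x)⁻¹) ^ 2 •
      ((1 - dot3 (comA A) (tauA A⁻¹ (SPinv x)))⁻¹ * Real.exp (2 * u (SPinv x)))) =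
      auxN A x * h x := by
    intro x
    have := (aux_pos x).ne'
    simp only [hh, hg, smul_eq_mul, aux_weight]
    field_simp
  have RV : ∀ (i : Fin 3) (x : ℝ × ℝ), (auxp A)⁻¹ * (((1 + sq2 x)⁻¹) ^ 2 *
      (((1 - dot3 (comA A) (tauA A⁻¹ (SPinv x)))⁻¹ * Real.exp (2 * u (SPinv x))) •
        tauA A⁻¹ (SPinv x)) i) = auxV A x i * h x := by
    intro i x
    have := (aux_pos x).ne'
    have := (aux_N_pos A x).ne'
    rw [aux_weight, aux_tau]
    simp only [hh, hg, Pi.smul_apply, smul_eq_mul]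
    field_simp
  have mL := aux_moment i0 i1 i2 i3 L
  have mL0 := aux_moment i0 i1 i2 i3 L0
  have mL1 := aux_moment i0 i1 i2 i3 L1
  have mL2 := aux_moment i0 i1 i2 i3 L2
  have mR := aux_moment i0 i1 i2 i3 fun x => (R x).trans (by rw [aux_N_expand])
  have mR0 := aux_moment i0 i1 i2 i3 fun x => (RV 0 x).trans (by rw [aux_V0_expand])
  have mR1 := aux_moment i0 i1 i2 i3 fun x => (RV 1 x).trans (by rw [aux_V1_expand])
  have mR2 := aux_moment i0 i1 i2 i3 fun x => (RV 2 x).trans (by rw [aux_V2_expand])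
  have hunit : IsUnit (auxp A)⁻¹ := (inv_ne_zero hp).isUnit
  rw [integrable_const_mul_iff hunit, integral_const_mul] at mR mR0 mR1 mR2
  have sL := aux_sphInt_apply (fun ω => Real.exp (2 * u ω) • ω)
    (fun i => by fin_cases i; exacts [mL0.1, mL1.1, mL2.1])
  have sR := aux_sphInt_apply (fun ω =>
    ((1 - dot3 (comA A) (tauA A⁻¹ ω))⁻¹ * Real.exp (2 * u ω)) • tauA A⁻¹ ω)
    (fun i => by fin_cases i; exacts [mR0.1, mR1.1, mR2.1])
  have hc : 1 - norm3sq (comA A) = ((auxp A)⁻¹) ^ 2 := by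
    obtain ⟨c0, c1, c2⟩ := aux_com A
    have hd := aux_hdet A
    simp only [norm3sq, dot3, c0, c1, c2]
    field_simp
    unfold auxp
    linear_combination 4 * hd
  simp only [norm3sq, dot3] at sR ⊢
  simp only [norm3sq, dot3] at hc mR mR0 mR1 mR2
  rw [hc]
  simp only [sL, sR]
  simp only [sphInt]
  have eL := mL.2
  have eL0 := mL0.2
  have eL1 := mL1.2
  have eL2 := mL2.2
  have eR := mR.2
  have eR0 := mR0.2
  have eR1 := mR1.2
  have eR2 := mR2.2
  rw [eL, eL0, eL1, eL2]
  rw [show ∀ a b c d q p : ℝ, q ^ 2 * ((p • a) ^ 2 - (p * b * (p * b) + p * c * (p * c)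
      + p * d * (p * d))) = p ^ 2 * ((q * a) ^ 2 - (q * b) ^ 2 - (q * c) ^ 2 - (q * d) ^ 2) from
      fun a b c d q p => by simp only [smul_eq_mul]; ring]
  rw [eR, eR0, eR1, eR2]
  have d1 := aux_det_re A
  have d2 := aux_det_im A
  have d3 : ((A.1 0 0).re * (A.1 1 1).re - (A.1 0 0).im * (A.1 1 1).im
      - ((A.1 0 1).re * (A.1 1 0).re - (A.1 0 1).im * (A.1 1 0).im)) ^ 2 +
    ((A.1 0 0).re * (A.1 1 1).im + (A.1 0 0).im * (A.1 1 1).re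
      - ((A.1 0 1).re * (A.1 1 0).im + (A.1 0 1).im * (A.1 1 0).re)) ^ 2 = 1 := by
    rw [d1, d2]; norm_num
  generalize (∫ x : ℝ × ℝ, 1 * h x) = E0
  generalize (∫ x : ℝ × ℝ, x.1 * h x) = E1
  generalize (∫ x : ℝ × ℝ, x.2 * h x) = E2
  generalize (∫ x : ℝ × ℝ, sq2 x * h x) = E3
  simp only [Complex.normSq_apply, smul_eq_mul]
  linear_combination (-(1 / Real.pi) ^ 2 * 4 * (E0 * E3 - E1 ^ 2 - E2 ^ 2)) * d3
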